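/- Let Ω ⊆ ℝⁿ be open, let e ∈ ℝⁿ be a constant vector, and let Γ^i_{jk}, c^i_{jk} : Ω → ℝ (i,j,k ∈ {1,…,n}) be smooth functions such that: Γ is symmetric in its lower indices with Σ_s Γ^i_{js} e^s = 0; c is commutative (c^i_{jk} = c^i_{kj}) and associative (Σ_s c^i_{js} c^s_{kt} = Σ_s c^i_{ks} c^s_{jt}) with unit e (Σ_j c^i_{jk} e^j = δ^i_k); and the covariant derivative ∇_l c^i_{jk} := ∂_l c^i_{jk} + Σ_m ( Γ^i_{lm} c^m_{jk} − Γ^m_{lj} c^i_{mk} − Γ^m_{lk} c^i_{jm} ) is totally symmetric in the three lower indices l,j,k. Define the curvature R^i_{tjk} := ∂_k Γ^i_{jt} − ∂_j Γ^i_{kt} + Σ_s ( Γ^i_{ks} Γ^s_{jt} − Γ^i_{js} Γ^s_{kt} ). Suppose X : Ω → ℝⁿ is twice continuously differentiable and satisfies ∂_k X^i = − Σ_s Γ^i_{ks} X^s + Σ_s c^i_{ks} ( Σ_m e^m ∂_m X^s ) for all i,k on Ω. Then for all i,j,k ∈ {1,…,n} and every point of Ω: Σ_t ( R^i_{tjk}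 + Σ_{s,m} c^i_{ks} R^s_{tmj} e^m + Σ_{s,m} c^i_{js} R^s_{tkm} e^m ) X^t = 0. -/

import Mathlib

/-- Partial derivative of a scalar function on `ℝⁿ` in the `j`-th coordinate direction. -/
noncomputable def pd {n : ℕ} (f : (Fin n → ℝ) → ℝ) (j : Fin n) (p : Fin n → ℝ) : ℝ :=
  fderiv ℝ f p (Pi.single j 1)

section Pd

variable {n : ℕ} {f g : (Fin n → ℝ) → ℝ} {p : Fin n → ℝ}

theorem pd_congr_of_isOpen {Ω : Set (Fin n → ℝ)} (hΩ : IsOpen Ω) (h : ∀ q ∈ Ω, f q = g q)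
    (hp : p ∈ Ω) (k : Fin n) : pd f k p = pd g k p := by
  have hfg : f =ᶠ[nhds p] g := Filter.eventually_of_mem (hΩ.mem_nhds hp) h
  rw [pd, pd, hfg.fderiv_eq]

theorem pd_add (hf : DifferentiableAt ℝ f p) (hg : DifferentiableAt ℝ g p) (k : Fin n) :
    pd (fun q => f q + g q) k p = pd f k p + pd g k p := by
  simp [pd, fderiv_fun_add hf hg]

theorem pd_neg (k : Fin n) : pd (fun q => -f q) k p = -pd f k p := by
  simp [pd, fderiv_fun_neg]

theorem pd_mul (hf : DifferentiableAt ℝ f p) (hg : DifferentiableAt ℝ g p) (k : Fin n) :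
    pd (fun q => f q * g q) k p = pd f k p * g p + f p * pd g k p := by
  simp [pd, fderiv_fun_mul hf hg]
  ring

theorem pd_sum {ι : Type*} [Fintype ι] {f : ι → (Fin n → ℝ) → ℝ}
    (hf : ∀ s, DifferentiableAt ℝ (f s) p) (k : Fin n) :
    pd (fun q => ∑ s, f s q) k p = ∑ s, pd (f s) k p := by
  simp [pd, fderiv_fun_sum fun s _ => hf s]

theorem ContDiffAt.differentiableAt_pd (hf : ContDiffAt ℝ 2 f p) (j : Fin n) :
    DifferentiableAt ℝ (pd f j) p := by
  have h : DifferentiableAt ℝ (fderiv ℝ f) p :=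
    (hf.fderiv_right (m := 1) (by norm_num)).differentiableAt (by norm_num)
  exact h.clm_apply (differentiableAt_const _)

theorem ContDiffAt.pd_comm (hf : ContDiffAt ℝ 2 f p) (j k : Fin n) :
    pd (pd f j) k p = pd (pd f k) j p := by
  have h : DifferentiableAt ℝ (fderiv ℝ f) p :=
    (hf.fderiv_right (m := 1) (by norm_num)).differentiableAt (by norm_num)
  have hpd : ∀ a b : Fin n, pd (pd f a) b p
      = fderiv ℝ (fderiv ℝ f) p (Pi.single b 1) (Pi.single a 1) := by
    intro a b
    change fderiv ℝ (fun q => fderiv ℝ f q (Pi.single a 1)) p (Pi.single b 1) = _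
    rw [fderiv_clm_apply h (differentiableAt_const _)]
    simp
  rw [hpd, hpd]
  exact (hf.isSymmSndFDerivAt (by simp)).eq _ _

end Pd

open Matrix in
/-- The commutator of covariant derivatives, in matrix form: if `∂_j x = -G_j x + C_j w` and
`∂_k x = -G_k x + C_k w` have equal mixed derivatives and `∇_k C_j = ∇_j C_k`, then
`R_{jk} x = C_j ∇_k w - C_k ∇_j w`. -/
theorem curvature_mulVec_eq {ι : Type*} [Fintype ι]
    {Gj Gk Cj Ck dkGj djGk dkCj djCk : Matrix ι ι ℝ} {x w djw dkw : ι → ℝ}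
    (hC : dkCj + Gk * Cj - Cj * Gk = djCk + Gj * Ck - Ck * Gj)
    (hx : -(dkGj *ᵥ x + Gj *ᵥ (-(Gk *ᵥ x) + Ck *ᵥ w)) + (dkCj *ᵥ w + Cj *ᵥ dkw)
      = -(djGk *ᵥ x + Gk *ᵥ (-(Gj *ᵥ x) + Cj *ᵥ w)) + (djCk *ᵥ w + Ck *ᵥ djw)) :
    (dkGj - djGk + (Gk * Gj - Gj * Gk)) *ᵥ x
      = Cj *ᵥ (dkw + Gk *ᵥ w) - Ck *ᵥ (djw + Gj *ᵥ w) := by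
  have hCw := congrArg (· *ᵥ w) hC
  simp only [add_mulVec, sub_mulVec, mulVec_add, mulVec_neg, mulVec_mulVec] at hCw hx ⊢
  linear_combination (norm := module) hCw - hx

/-- compatibility of the linear system `∇_k X^i = c^i_{ks} ∇_e X^s` forces the
curvature obstruction, contracted with any C² solution `X`, to vanish. -/
theorem symmetry_system_compatibility
    (n : ℕ) (Ω : Set (Fin n → ℝ)) (hΩ : IsOpen Ω)
    (e : Fin n → ℝ)
    (Γ c : Fin n → Fin n → Fin n → (Fin n → ℝ) → ℝ)
    (hΓsmooth : ∀ i j k, ContDiffOn ℝ (⊤ : ℕ∞) (Γ i j k) Ω)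
    (hcsmooth : ∀ i j k, ContDiffOn ℝ (⊤ : ℕ∞) (c i j k) Ω)
    (hΓsym : ∀ i j k, ∀ p ∈ Ω, Γ i j k p = Γ i k j p)
    (hΓe : ∀ i j, ∀ p ∈ Ω, ∑ s, Γ i j s p * e s = 0)
    (hcsym : ∀ i j k, ∀ p ∈ Ω, c i j k p = c i k j p)
    (hcassoc : ∀ i j k t, ∀ p ∈ Ω,
      ∑ s, c i j s p * c s k t p = ∑ s, c i k s p * c s j t p)
    (hcunit : ∀ i k, ∀ p ∈ Ω, ∑ j, c i j k p * e j = if i = k then (1 : ℝ) else 0)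
    -- the covariant derivative ∇_l c^i_{jk}
    (nc : Fin n → Fin n → Fin n → Fin n → (Fin n → ℝ) → ℝ)
    (hnc : ∀ l i j k p, nc l i j k p = pd (c i j k) l p
      + ∑ m, (Γ i l m p * c m j k p - Γ m l j p * c i m k p - Γ m l k p * c i j m p))
    -- ∇c is totally symmetric in the three lower indices l, j, k
    (hncsym₁ : ∀ l i j k, ∀ p ∈ Ω, nc l i j k p = nc j i l k p)
    (hncsym₂ : ∀ l i j k, ∀ p ∈ Ω, nc l i j k p = nc l i k j p)
    -- the curvature R^i_{tjk}
    (R : Fin n → Fin n → Fin n → Fin n → (Fin n → ℝ) → ℝ)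
    (hR : ∀ i t j k p, R i t j k p = pd (Γ i j t) k p - pd (Γ i k t) j p
      + ∑ s, (Γ i k s p * Γ s j t p - Γ i j s p * Γ s k t p))
    (X : (Fin n → ℝ) → (Fin n → ℝ))
    (hX : ∀ i, ContDiffOn ℝ 2 (fun u => X u i) Ω)
    (hXeq : ∀ i k, ∀ p ∈ Ω,
      pd (fun u => X u i) k p
        = -(∑ s, Γ i k s p * X p s)
          + ∑ s, c i k s p * (∑ m, e m * pd (fun u => X u s) m p)) :
    ∀ i j k, ∀ p ∈ Ω,
      ∑ t, (R i t j k p + (∑ s, ∑ m, c i k s p * R s t m j p * e m)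
        + (∑ s, ∑ m, c i j s p * R s t k m p * e m)) * X p t = 0 := by
  set W : Fin n → (Fin n → ℝ) → ℝ := fun s q => ∑ m, e m * pd (fun u => X u s) m q with hW
  intro i j k p hp
  have hΓd : ∀ i j k, DifferentiableAt ℝ (Γ i j k) p := fun i j k =>
    ((hΓsmooth i j k).contDiffAt (hΩ.mem_nhds hp)).differentiableAt (by simp)
  have hcd : ∀ i j k, DifferentiableAt ℝ (c i j k) p := fun i j k =>
    ((hcsmooth i j k).contDiffAt (hΩ.mem_nhds hp)).differentiableAt (by simp)
  have hX2 : ∀ i, ContDiffAt ℝ 2 (fun u => X u i) p := fun i =>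
    (hX i).contDiffAt (hΩ.mem_nhds hp)
  have hXd : ∀ i, DifferentiableAt ℝ (fun u => X u i) p := fun i =>
    (hX2 i).differentiableAt (by norm_num)
  have hWd : ∀ s, DifferentiableAt ℝ (W s) p := fun s =>
    DifferentiableAt.fun_sum fun m _ => ((hX2 s).differentiableAt_pd m).const_mul (e m)
  have hXW : ∀ i k, pd (fun u => X u i) k p
      = -(∑ s, Γ i k s p * X p s) + ∑ s, c i k s p * W s p := fun i k => hXeq i k p hp
  have hpd2 : ∀ i j k, pd (pd (fun u => X u i) j) k p
      = -(∑ s, pd (Γ i j s) k p * X p s + ∑ s, Γ i j s p * pd (fun u => X u s) k p)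
        + (∑ s, pd (c i j s) k p * W s p + ∑ s, c i j s p * pd (W s) k p) := by
    intro i j k
    rw [pd_congr_of_isOpen hΩ (hXeq i j) hp k,
      pd_add (DifferentiableAt.fun_sum fun s _ => (hΓd i j s).fun_mul (hXd s)).fun_neg
        (DifferentiableAt.fun_sum fun s _ => (hcd i j s).fun_mul (hWd s)), pd_neg,
      pd_sum fun s => (hΓd i j s).fun_mul (hXd s), pd_sum fun s => (hcd i j s).fun_mul (hWd s)]
    simp only [pd_mul (hΓd _ _ _) (hXd _), pd_mul (hcd _ _ _) (hWd _), Finset.sum_add_distrib]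
  set G : Fin n → Matrix (Fin n) (Fin n) ℝ := fun a => Matrix.of fun b d => Γ b a d p with hG
  set C : Fin n → Matrix (Fin n) (Fin n) ℝ := fun a => Matrix.of fun b d => c b a d p with hC
  set w : Fin n → ℝ := fun s => W s p with hw
  -- `D a` is the covariant derivative `∇_a W` at `p`
  set D : Fin n → Fin n → ℝ := fun a => (fun s => pd (W s) a p) + (G a).mulVec w with hD
  have key : ∀ j k i, ∑ t, R i t j k p * X p t
      = ∑ s, c i j s p * D k s - ∑ s, c i k s p * D j s := by
    intro j k
    have h := curvature_mulVec_eq (Gj := G j) (Gk := G k) (Cj := C j) (Ck := C k)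
      (dkGj := Matrix.of fun b d => pd (Γ b j d) k p)
      (djGk := Matrix.of fun b d => pd (Γ b k d) j p)
      (dkCj := Matrix.of fun b d => pd (c b j d) k p)
      (djCk := Matrix.of fun b d => pd (c b k d) j p)
      (x := X p) (w := w) (djw := fun s => pd (W s) j p) (dkw := fun s => pd (W s) k p) ?_ ?_
    · intro i
      have hi := congrFun h i
      simp only [Matrix.mulVec, dotProduct, Matrix.add_apply, Matrix.sub_apply, Matrix.mul_apply,
        Pi.sub_apply, hG, hC, Matrix.of_apply, ← Finset.sum_sub_distrib, ← hR] at hi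
      rw [← Finset.sum_sub_distrib, hi]
    · ext b d
      have hs := hncsym₁ k b j d p hp
      rw [hnc, hnc] at hs
      simp only [Finset.sum_sub_distrib] at hs
      have hΓ : ∑ m, Γ m k j p * c b m d p = ∑ m, Γ m j k p * c b m d p :=
        Finset.sum_congr rfl fun m _ => by rw [hΓsym m k j p hp]
      simp only [Matrix.add_apply, Matrix.sub_apply, Matrix.mul_apply, hG, hC, Matrix.of_apply]
      simp only [mul_comm (c b _ _ p)]
      linear_combination hs + hΓ
    · ext b
      have hs := (hX2 b).pd_comm j k
      rw [hpd2, hpd2] at hs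
      simp only [hXW] at hs
      exact hs
  have hce : ∀ (v : Fin n → ℝ) s, ∑ m, e m * ∑ r, c s m r p * v r = v s := by
    intro v s
    simp only [Finset.mul_sum]
    rw [Finset.sum_comm]
    have : ∀ r, ∑ m, e m * (c s m r p * v r) = (if s = r then 1 else 0) * v r := by
      intro r
      rw [← hcunit s r p hp, Finset.sum_mul]
      exact Finset.sum_congr rfl fun m _ => by ring
    simp [this]
  set E : Fin n → ℝ := fun s => ∑ m, e m * D m s with hE
  have hEc : ∀ a s, ∑ m, e m * ∑ r, c s a r p * D m r = ∑ r, c s a r p * E r := by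
    intro a s
    simp only [hE, Finset.mul_sum]
    rw [Finset.sum_comm]
    exact Finset.sum_congr rfl fun r _ => Finset.sum_congr rfl fun m _ => by ring
  have hRj : ∀ s, ∑ m, e m * ∑ t, R s t m j p * X p t = D j s - ∑ r, c s j r p * E r := by
    intro s
    simp only [key, mul_sub, Finset.sum_sub_distrib, hce, hEc]
  have hRk : ∀ s, ∑ m, e m * ∑ t, R s t k m p * X p t = ∑ r, c s k r p * E r - D k s := by
    intro s
    simp only [key, mul_sub, Finset.sum_sub_distrib, hce, hEc]
  have hpull : ∀ (a : Fin n → ℝ) (Q : Fin n → Fin n → Fin n → ℝ),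
      ∑ t, (∑ s, ∑ m, a s * Q s t m * e m) * X p t
        = ∑ s, a s * ∑ m, e m * ∑ t, Q s t m * X p t := by
    intro a Q
    simp only [Finset.sum_mul, Finset.mul_sum]
    rw [Finset.sum_comm]
    refine Finset.sum_congr rfl fun s _ => ?_
    rw [Finset.sum_comm]
    exact Finset.sum_congr rfl fun m _ => Finset.sum_congr rfl fun t _ => by ring
  have hassoc : ∑ s, c i k s p * ∑ r, c s j r p * E r = ∑ s, c i j s p * ∑ r, c s k r p * E r := by
    simp only [Finset.mul_sum]
    rw [Finset.sum_comm, Finset.sum_comm (f := fun s r => c i j s p * _)]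
    refine Finset.sum_congr rfl fun r _ => ?_
    simp only [← mul_assoc, ← Finset.sum_mul]
    rw [hcassoc i k j r p hp]
  simp only [add_mul, Finset.sum_add_distrib]
  rw [hpull (fun s => c i k s p) fun s t m => R s t m j p,
    hpull (fun s => c i j s p) fun s t m => R s t k m p]
  simp only [hRj, hRk, key j k i, mul_sub, Finset.sum_sub_distrib, hassoc]
  ring
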